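/- Let (X, ℝ, α) be a periodic one-parameter C*-dynamical system with X_1 ≠ {0} and X_n = {0} for all |n| ≥ 2 (so sp(α) = {−γ₁, 0, γ₁}), and suppose that J, the closed linear span of {x y* : x, y ∈ X_1}, is a two-sided ideal of X_0 having no norm-closed two-sided ideals other than {0} and J. Then: (i) I, the closed linear span of {x* y : x, y ∈ X_1}, is a two-sided ideal of X_0 having no norm-closed two-sided ideals other than {0} and I, and i j = 0 for all i ∈ I, j ∈ J; (ii) Z, the closed linear span of {a x b : a, b ∈ I + J, x ∈ X}, is a simple C*-algebra, i.e., it has no norm-closed two-sided ideals other than {0} and Z. -/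

import Mathlib

open MeasureTheory Set Filter Topology Pointwise

noncomputable section

namespace PeligradMax

variable {X : Type*} [NonUnitalNormedRing X] [StarRing X] [CStarRing X]
  [NormedSpace ℂ X] [IsScalarTower ℂ X X] [SMulCommClass ℂ X X] [StarModule ℂ X]
  [CompleteSpace X] [PartialOrder X] [StarOrderedRing X]

/-- A one-parameter C*-dynamical system: a group of *-automorphisms of `X`
with norm-continuous orbit maps. -/
structure IsCStarDynSys (α : ℝ → X → X) : Prop where
  map_zero_time : ∀ x, α 0 x = x
  map_add_time : ∀ s t x, α (s + t) x = α s (α t x)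
  map_add : ∀ t x y, α t (x + y) = α t x + α t y
  map_smulc : ∀ (t : ℝ) (c : ℂ) (x : X), α t (c • x) = c • α t x
  map_mul : ∀ t x y, α t (x * y) = α t x * α t y
  map_star : ∀ t x, α t (star x) = star (α t x)
  continuous_orbit : ∀ x, Continuous fun t => α t x

/-- Closed linear span. -/
def ClosedSpan (S : Set X) : Set X := closure ((Submodule.span ℂ S : Submodule ℂ X) : Set X)

def MulSet2 (S T : Set X) : Set X := {z | ∃ s ∈ S, ∃ t ∈ T, z = s * t}

def MulSet3 (S T R : Set X) : Set X := {z | ∃ s ∈ S, ∃ t ∈ T, ∃ r ∈ R, z = s * t * r}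

/-- Fourier transform of an integrable function. -/
def fourierT (f : ℝ → ℂ) (γ : ℝ) : ℂ := ∫ t : ℝ, f t * Complex.exp (-(Complex.I * γ * t))

/-- `α_f(x) = ∫ f(t) α_t(x) dt`. -/
def smear (α : ℝ → X → X) (f : ℝ → ℂ) (x : X) : X := ∫ t : ℝ, f t • α t x

/-- Arveson spectrum of an element. -/
def elemSpec (α : ℝ → X → X) (x : X) : Set ℝ :=
  {γ | ∀ f : ℝ → ℂ, Integrable f → smear α f x = 0 → fourierT f γ = 0}

/-- Spectral subspace associated with a closed set `F ⊆ ℝ`. -/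
def specC (α : ℝ → X → X) (F : Set ℝ) : Set X := {x | elemSpec α x ⊆ F}

/-- Spectral subspace of the subset `S` associated with an open set `U ⊆ ℝ`. -/
def specO (α : ℝ → X → X) (S : Set X) (U : Set ℝ) : Set X :=
  ClosedSpan {y | ∃ x ∈ S, ∃ f : ℝ → ℂ, Integrable f ∧
    IsCompact (tsupport (fourierT f)) ∧ tsupport (fourierT f) ⊆ U ∧ y = smear α f x}

/-- The fixed point algebra `X^α`. -/
def fixedPts (α : ℝ → X → X) : Set X := {x | ∀ t, α t x = x}

/-- The Arveson spectrum of the action restricted to `S`. -/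
def actSpec (α : ℝ → X → X) (S : Set X) : Set ℝ :=
  {γ : ℝ | ∀ ε > (0 : ℝ), S ∩ specC α (Icc (γ - ε) (γ + ε)) ≠ ({0} : Set X)}

def Invariant (α : ℝ → X → X) (S : Set X) : Prop := ∀ t : ℝ, ∀ x ∈ S, α t x ∈ S

def IsSubalgebra (B : Set X) : Prop :=
  (0 : X) ∈ B ∧ (∀ x ∈ B, ∀ y ∈ B, x + y ∈ B) ∧
  (∀ c : ℂ, ∀ x ∈ B, c • x ∈ B) ∧ ∀ x ∈ B, ∀ y ∈ B, x * y ∈ B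

def IsStarSubalgebra (B : Set X) : Prop := IsSubalgebra B ∧ ∀ x ∈ B, star x ∈ B

/-- `B` is a hereditary C*-subalgebra of the subset `S`. -/
def IsHereditaryIn (S B : Set X) : Prop :=
  B ⊆ S ∧ IsClosed B ∧ IsStarSubalgebra B ∧
  ∀ x ∈ S, ∀ b ∈ B, 0 ≤ x → x ≤ b → x ∈ B

/-- `K` is a norm-closed two-sided ideal of the subset `S`. -/
def IsClosedTwoSidedIdealIn (S K : Set X) : Prop :=
  K ⊆ S ∧ IsClosed K ∧ (0 : X) ∈ K ∧ (∀ x ∈ K, ∀ y ∈ K, x + y ∈ K) ∧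
  (∀ c : ℂ, ∀ x ∈ K, c • x ∈ K) ∧ ∀ s ∈ S, ∀ k ∈ K, s * k ∈ K ∧ k * s ∈ K

/-- `S` is `α`-simple: no nontrivial norm-closed `α`-invariant two-sided ideals. -/
def AlphaSimple (α : ℝ → X → X) (S : Set X) : Prop :=
  ∀ K : Set X, IsClosedTwoSidedIdealIn S K → Invariant α K → K = ({0} : Set X) ∨ K = S

/-- The strong Arveson spectrum of the action restricted to `B`. -/
def strongSpec (α : ℝ → X → X) (B : Set X) : Set ℝ :=
  {γ : ℝ | ∀ ε > (0 : ℝ),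
    ClosedSpan (MulSet3 (star '' (B ∩ specC α (Icc (γ - ε) (γ + ε)))) B
      (B ∩ specC α (Icc (γ - ε) (γ + ε)))) = B}

/-- The strong Connes spectrum of the action restricted to `S`. -/
def ConnesSpec (α : ℝ → X → X) (S : Set X) : Set ℝ :=
  ⋂ B ∈ {B : Set X | IsHereditaryIn S B ∧ B ≠ ({0} : Set X) ∧ Invariant α B},
    strongSpec α B

def IsMaximalClosedSubalgebra (B : Set X) : Prop :=
  IsClosed B ∧ IsSubalgebra B ∧ B ≠ (univ : Set X) ∧
  ∀ W : Set X, IsClosed W → IsSubalgebra W → B ⊆ W → W = B ∨ W = univ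

/-- The spectral Condition 4.3. -/
def Condition43 (α : ℝ → X → X) : Prop :=
  (∃ γ₀ : ℝ, 0 < γ₀ ∧ actSpec α (univ : Set X) = ({-γ₀, 0, γ₀} : Set ℝ) ∧
    IsClosedTwoSidedIdealIn (fixedPts α)
      (ClosedSpan (MulSet2 (specC α ({γ₀} : Set ℝ)) (star '' specC α ({γ₀} : Set ℝ)))) ∧
    ∀ K : Set X,
      IsClosedTwoSidedIdealIn
        (ClosedSpan (MulSet2 (specC α ({γ₀} : Set ℝ)) (star '' specC α ({γ₀} : Set ℝ)))) K →
      K = ({0} : Set X) ∨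
        K = ClosedSpan (MulSet2 (specC α ({γ₀} : Set ℝ)) (star '' specC α ({γ₀} : Set ℝ)))) ∨
  (∃ Y : Set X, IsClosedTwoSidedIdealIn (univ : Set X) Y ∧ Invariant α Y ∧ AlphaSimple α Y ∧
    specO α Y (Ioi (0 : ℝ)) = specO α (univ : Set X) (Ioi (0 : ℝ)) ∧
    actSpec α Y = ConnesSpec α Y ∧
    closure (Y + specC α (Ici (0 : ℝ))) = (univ : Set X))

/-- The spectral subspace `X_n` of a periodic system with period `2π/γ₁`. -/
def specZ (α : ℝ → X → X) (γ₁ : ℝ) (n : ℤ) : Set X :=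
  {x | ∀ t : ℝ, α t x = Complex.exp (Complex.I * (((n : ℝ) * γ₁ * t : ℝ) : ℂ)) • x}

/-- Condition (S) for a periodic system. -/
def ConditionS (α : ℝ → X → X) (γ₁ : ℝ) : Prop :=
  ∃ J : Set X, IsClosedTwoSidedIdealIn (specZ α γ₁ 0) J ∧
    (∀ K : Set X, IsClosedTwoSidedIdealIn J K → K = ({0} : Set X) ∨ K = J) ∧
    ∀ n : ℤ, 0 < n → specZ α γ₁ n ≠ ({0} : Set X) →
      ClosedSpan {z : X | ∃ x ∈ specZ α γ₁ n, ∃ y ∈ specZ α γ₁ n, z = x * star y} = J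

section Absorption

variable {A : Type*} [NonUnitalCStarAlgebra A]

/-- Every element of a C*-algebra is absorbed on the right by an approximate unit. -/
lemma exists_norm_sub_mul_lt (a : A) {ε : ℝ} (hε : 0 < ε) : ∃ e : A, ‖e‖ ≤ 1 ∧ ‖a - a * e‖ < ε := by
  let _ := CStarAlgebra.spectralOrder A
  have := CStarAlgebra.spectralOrderedRing A
  have hu := CStarAlgebra.increasingApproximateUnit (A := A)
  have h1 := (Metric.tendsto_nhds.1 (hu.tendsto_mul_left a)) ε hε
  obtain ⟨e, he, hae⟩ := (hu.eventually_norm.and h1).exists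
  exact ⟨e, he, by rwa [dist_comm, dist_eq_norm] at hae⟩

lemma exists_mem_elemental_norm_sub_mul_lt (x : A) {ε : ℝ} (hε : 0 < ε) :
    ∃ e ∈ NonUnitalStarAlgebra.elemental ℂ (star x * x), ‖x - x * e‖ < ε := by
  obtain ⟨e, he, h⟩ := exists_norm_sub_mul_lt
    (⟨star x * x, NonUnitalStarAlgebra.elemental.self_mem ℂ _⟩ :
      NonUnitalStarAlgebra.elemental ℂ (star x * x)) (ε := ε ^ 2 / 2) (by positivity)
  refine ⟨e, e.2, ?_⟩
  have he' : ‖(e : A)‖ ≤ 1 := he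
  have h' : ‖star x * x - star x * x * e‖ < ε ^ 2 / 2 := h
  set b := star x * x - star x * x * e with hb
  have key : star (x - x * e) * (x - x * e) = b - star (e : A) * b := by
    simp only [hb, star_sub, star_mul, sub_mul, mul_sub, mul_assoc]
    abel
  have : ‖x - x * e‖ * ‖x - x * e‖ < ε ^ 2 := by
    rw [← CStarRing.norm_star_mul_self, key]
    calc ‖b - star (e : A) * b‖ ≤ ‖b‖ + ‖star (e : A)‖ * ‖b‖ :=
          (norm_sub_le _ _).trans (by gcongr; exact norm_mul_le _ _)
      _ ≤ ‖b‖ + 1 * ‖b‖ := by rw [norm_star]; gcongr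
      _ < ε ^ 2 := by linarith
  nlinarith [norm_nonneg (x - x * e)]

/-- The elements which multiply, together with their adjoints, both `x` and `N` into `N`. -/
def rightMultipliers (N : Submodule ℂ A) (x : A) : NonUnitalStarSubalgebra ℂ A where
  carrier := {e | (x * e ∈ N ∧ x * star e ∈ N) ∧ ∀ n ∈ N, n * e ∈ N ∧ n * star e ∈ N}
  add_mem' := by
    rintro a b ⟨⟨ha, ha'⟩, hN⟩ ⟨⟨hb, hb'⟩, hN'⟩
    simp only [mem_ofPred_eq, star_add, mul_add]
    exact ⟨⟨N.add_mem ha hb, N.add_mem ha' hb'⟩, fun n hn =>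
      ⟨N.add_mem (hN n hn).1 (hN' n hn).1, N.add_mem (hN n hn).2 (hN' n hn).2⟩⟩
  zero_mem' := by simp
  smul_mem' := by
    rintro c a ⟨⟨ha, ha'⟩, hN⟩
    simp only [mem_ofPred_eq, star_smul, mul_smul_comm]
    exact ⟨⟨N.smul_mem _ ha, N.smul_mem _ ha'⟩, fun n hn =>
      ⟨N.smul_mem _ (hN n hn).1, N.smul_mem _ (hN n hn).2⟩⟩
  mul_mem' := by
    rintro a b ⟨⟨ha, ha'⟩, hN⟩ ⟨⟨hb, hb'⟩, hN'⟩
    simp only [mem_ofPred_eq, star_mul, ← mul_assoc]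
    exact ⟨⟨(hN' _ ha).1, (hN _ hb').2⟩, fun n hn =>
      ⟨(hN' _ (hN n hn).1).1, (hN _ (hN' n hn).2).2⟩⟩
  star_mem' := by
    rintro a ⟨⟨ha, ha'⟩, hN⟩
    simp only [mem_ofPred_eq, star_star]
    exact ⟨⟨ha', ha⟩, fun n hn => (hN n hn).symm⟩

lemma isClosed_rightMultipliers {N : Submodule ℂ A} (hN : IsClosed (N : Set A)) (x : A) :
    IsClosed (rightMultipliers N x : Set A) := by
  have hl (y : A) : IsClosed {e : A | y * e ∈ N} :=
    hN.preimage (continuous_const.mul continuous_id)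
  have hs (y : A) : IsClosed {e : A | y * star e ∈ N} :=
    hN.preimage (continuous_const.mul continuous_star)
  have : (rightMultipliers N x : Set A) = ({e | x * e ∈ N} ∩ {e | x * star e ∈ N}) ∩
      ⋂ n ∈ N, ({e | n * e ∈ N} ∩ {e | n * star e ∈ N}) := by
    ext e
    simp only [mem_inter_iff, mem_iInter]
    exact Iff.rfl
  rw [this]
  exact ((hl x).inter (hs x)).inter
    (isClosed_iInter fun n => isClosed_iInter fun _ => (hl n).inter (hs n))

/-- A closed subspace `N` stable under right multiplication by `x* x` contains `x` as soon as it
contains `x x* x`. -/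
lemma mem_of_mul_star_mul_mem {N : Submodule ℂ A} (hN : IsClosed (N : Set A)) {x : A}
    (hx : x * (star x * x) ∈ N) (hmul : ∀ n ∈ N, n * (star x * x) ∈ N) : x ∈ N := by
  have hle : NonUnitalStarAlgebra.elemental ℂ (star x * x) ≤ rightMultipliers N x :=
    NonUnitalStarAlgebra.elemental.le_of_mem (isClosed_rightMultipliers hN x)
      ⟨⟨hx, by simpa using hx⟩, fun n hn => ⟨hmul n hn, by simpa using hmul n hn⟩⟩
  rw [← SetLike.mem_coe, ← hN.closure_eq, Metric.mem_closure_iff]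
  intro ε hε
  obtain ⟨e, he, hlt⟩ := exists_mem_elemental_norm_sub_mul_lt x hε
  exact ⟨x * e, (hle he).1.1, by rwa [dist_eq_norm]⟩

end Absorption

section ClosedSpan

variable {A : Type*} [NonUnitalCStarAlgebra A] {S T : Set A}

lemma subset_closedSpan (S : Set A) : S ⊆ ClosedSpan S :=
  Submodule.subset_span.trans subset_closure

lemma isClosed_closedSpan (S : Set A) : IsClosed (ClosedSpan S) := isClosed_closure

/-- The closed linear span as a subspace. -/
def closedSpanSubmodule (S : Set A) : Submodule ℂ A := (Submodule.span ℂ S).topologicalClosure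

lemma mem_closedSpanSubmodule {a : A} : a ∈ closedSpanSubmodule S ↔ a ∈ ClosedSpan S := Iff.rfl

lemma isClosed_closedSpanSubmodule (S : Set A) : IsClosed (closedSpanSubmodule S : Set A) :=
  isClosed_closure

lemma map_mem_of_mem_closedSpan {N : Submodule ℂ A} (hN : IsClosed (N : Set A)) (f : A →L[ℂ] A)
    (h : ∀ s ∈ S, f s ∈ N) {a : A} (ha : a ∈ ClosedSpan S) : f a ∈ N :=
  (Submodule.span ℂ S).topologicalClosure_minimal (t := N.comap (f : A →ₗ[ℂ] A))
    (Submodule.span_le.2 h) (hN.preimage f.continuous) ha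

lemma map₂_mem_of_mem_closedSpan {N : Submodule ℂ A} (hN : IsClosed (N : Set A))
    (f : A →L[ℂ] A →L[ℂ] A) (h : ∀ s ∈ S, ∀ t ∈ T, f s t ∈ N) {a b : A}
    (ha : a ∈ ClosedSpan S) (hb : b ∈ ClosedSpan T) : f a b ∈ N :=
  map_mem_of_mem_closedSpan hN (f a)
    (fun t ht => map_mem_of_mem_closedSpan hN (f.flip t) (fun s hs => h s hs t ht) ha) hb

lemma mem_of_mem_closedSpan {N : Submodule ℂ A} (hN : IsClosed (N : Set A))
    (h : ∀ s ∈ S, s ∈ N) {a : A} (ha : a ∈ ClosedSpan S) : a ∈ N :=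
  map_mem_of_mem_closedSpan hN (.id ℂ A) h ha

lemma mul_mem_of_mem_closedSpan {N : Submodule ℂ A} (hN : IsClosed (N : Set A))
    (h : ∀ s ∈ S, ∀ t ∈ T, s * t ∈ N) {a b : A}
    (ha : a ∈ ClosedSpan S) (hb : b ∈ ClosedSpan T) : a * b ∈ N :=
  map₂_mem_of_mem_closedSpan hN (.mul ℂ A) h ha hb

lemma mul_mul_mem_of_mem_closedSpan {N : Submodule ℂ A} (hN : IsClosed (N : Set A)) (w : A)
    (h : ∀ s ∈ S, ∀ t ∈ T, s * w * t ∈ N) {a b : A}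
    (ha : a ∈ ClosedSpan S) (hb : b ∈ ClosedSpan T) : a * w * b ∈ N :=
  map₂_mem_of_mem_closedSpan hN
    ((ContinuousLinearMap.mul ℂ A).comp ((ContinuousLinearMap.mul ℂ A).flip w)) h ha hb

lemma star_mem_closedSpan (h : ∀ s ∈ S, star s ∈ ClosedSpan S) {a : A} (ha : a ∈ ClosedSpan S) :
    star a ∈ ClosedSpan S := by
  rw [← (isClosed_closedSpan S).closure_eq]
  refine map_mem_closure continuous_star ha fun b hb => ?_
  induction hb using Submodule.span_induction with
  | mem b hb => exact h b hb
  | zero => exact (star_zero A).symm ▸ (closedSpanSubmodule S).zero_mem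
  | add b c _ _ hb hc => exact (star_add b c).symm ▸ (closedSpanSubmodule S).add_mem hb hc
  | smul c b _ hb => exact (star_smul c b).symm ▸ (closedSpanSubmodule S).smul_mem _ hb

/-- A closed two-sided ideal as a subspace. -/
def IsClosedTwoSidedIdealIn.toSubmodule {K : Set A} (hK : IsClosedTwoSidedIdealIn S K) :
    Submodule ℂ A where
  carrier := K
  zero_mem' := hK.2.2.1
  add_mem' := fun ha hb => hK.2.2.2.1 _ ha _ hb
  smul_mem' := fun c _ ha => hK.2.2.2.2.1 c _ ha

lemma isClosedTwoSidedIdealIn_closedSpan (h : ClosedSpan T ⊆ S)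
    (hl : ∀ s ∈ S, ∀ t ∈ T, s * t ∈ ClosedSpan T) (hr : ∀ s ∈ S, ∀ t ∈ T, t * s ∈ ClosedSpan T) :
    IsClosedTwoSidedIdealIn S (ClosedSpan T) :=
  ⟨h, isClosed_closedSpan T, (closedSpanSubmodule T).zero_mem,
    fun _ ha _ hb => (closedSpanSubmodule T).add_mem ha hb,
    fun c _ ha => (closedSpanSubmodule T).smul_mem c ha, fun s hs _ hk =>
    ⟨map_mem_of_mem_closedSpan (isClosed_closedSpanSubmodule T) (.mul ℂ A s) (hl s hs) hk,
      map_mem_of_mem_closedSpan (isClosed_closedSpanSubmodule T)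
        ((ContinuousLinearMap.mul ℂ A).flip s) (hr s hs) hk⟩⟩

end ClosedSpan

section Corner

variable {A : Type*} [NonUnitalCStarAlgebra A]

/-- The closed linear span of `V* V`. -/
abbrev sourceAlgebra (V : Set A) : Set A := ClosedSpan {z : A | ∃ x ∈ V, ∃ y ∈ V, z = star x * y}

/-- The closed linear span of `V V*`. -/
abbrev rangeAlgebra (V : Set A) : Set A := ClosedSpan {z : A | ∃ x ∈ V, ∃ y ∈ V, z = x * star y}

/-- The algebraic properties of the extreme spectral subspace of an action with three-point
spectrum. -/
structure IsCorner (V : Set A) : Prop where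
  mul_eq_zero : ∀ x ∈ V, ∀ y ∈ V, x * y = 0
  mul_mul_mem : ∀ x ∈ V, ∀ k : A, ∀ y ∈ V, x * k * y ∈ V
  exists_mul_star : ∀ x ∈ V, ∀ k : A, ∀ y ∈ V, ∃ x' ∈ V, x * k * star y = x' * star y

variable {V : Set A} {a b i j k x y : A}

lemma star_mul_mem_sourceAlgebra (hx : x ∈ V) (hy : y ∈ V) : star x * y ∈ sourceAlgebra V :=
  subset_closedSpan _ ⟨x, hx, y, hy, rfl⟩

lemma mul_star_mem_rangeAlgebra (hx : x ∈ V) (hy : y ∈ V) : x * star y ∈ rangeAlgebra V :=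
  subset_closedSpan _ ⟨x, hx, y, hy, rfl⟩

lemma star_mem_sourceAlgebra (ha : a ∈ sourceAlgebra V) : star a ∈ sourceAlgebra V := by
  refine star_mem_closedSpan ?_ ha
  rintro _ ⟨x, hx, y, hy, rfl⟩
  simpa using star_mul_mem_sourceAlgebra hy hx

lemma star_mem_rangeAlgebra (ha : a ∈ rangeAlgebra V) : star a ∈ rangeAlgebra V := by
  refine star_mem_closedSpan ?_ ha
  rintro _ ⟨x, hx, y, hy, rfl⟩
  simpa using mul_star_mem_rangeAlgebra hy hx

/-- The sum of the closed spans of `V* V` and `V V*`. -/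
abbrev diagonalAlgebra (V : Set A) : Set A := sourceAlgebra V + rangeAlgebra V

/-- The closed linear span of `D A D`, where `D` is the diagonal algebra of `V`. -/
abbrev linkingAlgebra (V : Set A) : Set A :=
  ClosedSpan (MulSet3 (diagonalAlgebra V) univ (diagonalAlgebra V))

lemma source_subset_diagonal : sourceAlgebra V ⊆ diagonalAlgebra V :=
  fun a ha => ⟨a, ha, 0, (closedSpanSubmodule _).zero_mem, add_zero a⟩

lemma range_subset_diagonal : rangeAlgebra V ⊆ diagonalAlgebra V :=
  fun a ha => ⟨0, (closedSpanSubmodule _).zero_mem, a, ha, zero_add a⟩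

namespace IsCorner

lemma mul_mem_sourceAlgebra (hV : IsCorner V) (ha : a ∈ sourceAlgebra V)
    (hb : b ∈ sourceAlgebra V) : a * b ∈ sourceAlgebra V := by
  refine mul_mem_of_mem_closedSpan (isClosed_closedSpanSubmodule _) ?_ ha hb
  rintro _ ⟨x, hx, y, hy, rfl⟩ _ ⟨z, hz, w, hw, rfl⟩
  rw [mul_assoc, ← mul_assoc y]
  exact star_mul_mem_sourceAlgebra hx (hV.mul_mul_mem y hy _ w hw)

lemma mul_mem_rangeAlgebra (hV : IsCorner V) (ha : a ∈ rangeAlgebra V)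
    (hb : b ∈ rangeAlgebra V) : a * b ∈ rangeAlgebra V := by
  refine mul_mem_of_mem_closedSpan (isClosed_closedSpanSubmodule _) ?_ ha hb
  rintro _ ⟨x, hx, y, hy, rfl⟩ _ ⟨z, hz, w, hw, rfl⟩
  rw [← mul_assoc]
  exact mul_star_mem_rangeAlgebra (hV.mul_mul_mem x hx _ z hz) hw

lemma source_mul_range (hV : IsCorner V) (hi : i ∈ sourceAlgebra V) (hj : j ∈ rangeAlgebra V) :
    i * j = 0 := by
  refine (Submodule.mem_bot ℂ).1 (mul_mem_of_mem_closedSpan isClosed_singleton ?_ hi hj)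
  rintro _ ⟨x, hx, y, hy, rfl⟩ _ ⟨z, hz, w, hw, rfl⟩
  rw [mul_assoc, ← mul_assoc y, hV.mul_eq_zero y hy z hz]
  simp

lemma range_mul_source (hV : IsCorner V) (hi : i ∈ sourceAlgebra V) (hj : j ∈ rangeAlgebra V) :
    j * i = 0 := by
  rw [← star_eq_zero, star_mul]
  exact hV.source_mul_range (star_mem_sourceAlgebra hi) (star_mem_rangeAlgebra hj)

/-- A closed right `V* V`-module containing `V* J V`, where `J` is the closed span of `V V*`,
contains the closed span of `V* V`. -/
lemma sourceAlgebra_subset (hV : IsCorner V) {N : Submodule ℂ A} (hN : IsClosed (N : Set A))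
    (h : ∀ x ∈ V, ∀ j ∈ rangeAlgebra V, ∀ y ∈ V, star x * j * y ∈ N)
    (hmul : ∀ n ∈ N, ∀ i ∈ sourceAlgebra V, n * i ∈ N) : sourceAlgebra V ⊆ N := by
  have hII : ∀ a ∈ sourceAlgebra V, ∀ b ∈ sourceAlgebra V, a * b ∈ N := by
    intro a ha b hb
    refine mul_mem_of_mem_closedSpan hN ?_ ha hb
    rintro _ ⟨x, hx, y, hy, rfl⟩ _ ⟨z, hz, w, hw, rfl⟩
    have := h x hx _ (mul_star_mem_rangeAlgebra hy hz) w hw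
    simpa only [mul_assoc] using this
  intro i hi
  have hsi := hV.mul_mem_sourceAlgebra (star_mem_sourceAlgebra hi) hi
  exact mem_of_mul_star_mul_mem hN (hII _ hi _ hsi) fun n hn => hmul n hn _ hsi

lemma eq_zero_of_mul_mul_eq_zero (h : star k * k * star k = 0) : k = 0 := by
  rw [← CStarRing.star_mul_self_eq_zero_iff, ← CStarRing.star_mul_self_eq_zero_iff]
  rw [star_mul, star_star, ← mul_assoc, h, zero_mul]

/-- If the closed span of `V V*` is simple, then so is the closed span of `V* V`. -/
theorem sourceAlgebra_simple (hV : IsCorner V)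
    (hsimple : ∀ K, IsClosedTwoSidedIdealIn (rangeAlgebra V) K → K = {0} ∨ K = rangeAlgebra V)
    (K : Set A) (hK : IsClosedTwoSidedIdealIn (sourceAlgebra V) K) :
    K = {0} ∨ K = sourceAlgebra V := by
  set T : Set A := {z | ∃ x ∈ V, ∃ k ∈ K, ∃ y ∈ V, z = x * k * star y} with hT
  have hTR : ClosedSpan T ⊆ rangeAlgebra V := fun a ha => by
    refine mem_of_mem_closedSpan (isClosed_closedSpanSubmodule _) ?_ ha
    rintro _ ⟨x, hx, k, -, y, hy, rfl⟩
    obtain ⟨x', hx', h⟩ := hV.exists_mul_star x hx k y hy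
    exact h ▸ mul_star_mem_rangeAlgebra hx' hy
  have hL : IsClosedTwoSidedIdealIn (rangeAlgebra V) (ClosedSpan T) := by
    refine isClosedTwoSidedIdealIn_closedSpan hTR (fun s hs t ht => ?_) fun s hs t ht => ?_
    · refine mul_mem_of_mem_closedSpan (isClosed_closedSpanSubmodule T) ?_ hs
        (subset_closedSpan T ht)
      rintro _ ⟨z, hz, w, hw, rfl⟩ _ ⟨x, hx, k, hk, y, hy, rfl⟩
      exact subset_closedSpan T ⟨z * star w * x, hV.mul_mul_mem z hz _ x hx, k, hk, y, hy, by
        simp only [mul_assoc]⟩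
    · refine mul_mem_of_mem_closedSpan (isClosed_closedSpanSubmodule T) ?_
        (subset_closedSpan T ht) hs
      rintro _ ⟨x, hx, k, hk, y, hy, rfl⟩ _ ⟨z, hz, w, hw, rfl⟩
      exact subset_closedSpan T ⟨x, hx, k, hk, w * star z * y, hV.mul_mul_mem w hw _ y hy, by
        simp only [mul_assoc, star_mul, star_star]⟩
  obtain ⟨hKI, hKc, hK0, -, -, hKmul⟩ := id hK
  rcases hsimple _ hL with h0 | hJ
  · left
    refine subset_antisymm (fun k hk => ?_) (by simpa using hK0)
    have hVkV : ∀ x ∈ V, ∀ y ∈ V, x * k * star y = 0 := fun x hx y hy => by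
      have : x * k * star y ∈ ClosedSpan T := subset_closedSpan T ⟨x, hx, k, hk, y, hy, rfl⟩
      simpa [h0] using this
    have hs := star_mem_sourceAlgebra (hKI hk)
    refine eq_zero_of_mul_mul_eq_zero ((Submodule.mem_bot ℂ).1
      (mul_mul_mem_of_mem_closedSpan isClosed_singleton k ?_ hs hs))
    rintro _ ⟨x, hx, y, hy, rfl⟩ _ ⟨z, hz, w, hw, rfl⟩
    rw [show star x * y * k * (star z * w) = star x * (y * k * star z) * w by
      simp only [mul_assoc], hVkV y hy z hz]
    simp
  · right
    refine subset_antisymm hKI (hV.sourceAlgebra_subset (N := hK.toSubmodule) hKc ?_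
      fun n hn i hi => (hKmul i hi n hn).2)
    intro x hx j hj y hy
    rw [← hJ] at hj
    refine map_mem_of_mem_closedSpan (N := hK.toSubmodule) hKc ((ContinuousLinearMap.mul ℂ A).flip y
      ∘L ContinuousLinearMap.mul ℂ A (star x)) ?_ hj
    rintro _ ⟨z, hz, k, hk, w, hw, rfl⟩
    have := (hKmul _ (star_mul_mem_sourceAlgebra hw hy) _
      (hKmul _ (star_mul_mem_sourceAlgebra hx hz) _ hk).1).2
    change star x * (z * k * star w) * y ∈ K
    simpa only [mul_assoc] using this

lemma mul_mem_diagonalAlgebra (hV : IsCorner V) (ha : a ∈ diagonalAlgebra V)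
    (hb : b ∈ diagonalAlgebra V) : a * b ∈ diagonalAlgebra V := by
  obtain ⟨i, hi, j, hj, rfl⟩ := ha
  obtain ⟨i', hi', j', hj', rfl⟩ := hb
  refine ⟨i * i', hV.mul_mem_sourceAlgebra hi hi', j * j', hV.mul_mem_rangeAlgebra hj hj', ?_⟩
  simp only [add_mul, mul_add, hV.source_mul_range hi hj', hV.range_mul_source hi' hj,
    zero_add, add_zero]

lemma star_mem_diagonalAlgebra (ha : a ∈ diagonalAlgebra V) : star a ∈ diagonalAlgebra V := by
  obtain ⟨i, hi, j, hj, rfl⟩ := ha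
  exact ⟨_, star_mem_sourceAlgebra hi, _, star_mem_rangeAlgebra hj, (star_add i j).symm⟩

lemma diagonal_subset_closedSpan_mul (hV : IsCorner V) :
    diagonalAlgebra V ⊆ ClosedSpan (MulSet2 (diagonalAlgebra V) (diagonalAlgebra V)) := by
  intro c hc
  have hcl := isClosed_closedSpanSubmodule (MulSet2 (diagonalAlgebra V) (diagonalAlgebra V))
  have hcc := hV.mul_mem_diagonalAlgebra (star_mem_diagonalAlgebra hc) hc
  refine mem_of_mul_star_mul_mem hcl (subset_closedSpan _ ⟨c, hc, _, hcc, rfl⟩) fun n hn =>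
    map_mem_of_mem_closedSpan hcl ((ContinuousLinearMap.mul ℂ A).flip (star c * c)) ?_ hn
  rintro _ ⟨d, hd, e, he, rfl⟩
  exact subset_closedSpan _ ⟨d, hd, _, hV.mul_mem_diagonalAlgebra he hcc, mul_assoc d e _⟩

lemma mul_mul_mem_linkingAlgebra (ha : a ∈ diagonalAlgebra V) (x : A)
    (hb : b ∈ diagonalAlgebra V) : a * x * b ∈ linkingAlgebra V :=
  subset_closedSpan _ ⟨a, ha, x, mem_univ x, b, hb, rfl⟩

lemma linkingAlgebra_mul_mem (hV : IsCorner V) (ha : a ∈ linkingAlgebra V)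
    (hb : b ∈ diagonalAlgebra V) : a * b ∈ linkingAlgebra V := by
  refine map_mem_of_mem_closedSpan (isClosed_closedSpanSubmodule _)
    ((ContinuousLinearMap.mul ℂ A).flip b) ?_ ha
  rintro _ ⟨c, hc, x, -, d, hd, rfl⟩
  change c * x * d * b ∈ linkingAlgebra V
  rw [mul_assoc _ d]
  exact mul_mul_mem_linkingAlgebra hc x (hV.mul_mem_diagonalAlgebra hd hb)

lemma star_mem_linkingAlgebra (ha : a ∈ linkingAlgebra V) : star a ∈ linkingAlgebra V := by
  refine star_mem_closedSpan ?_ ha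
  rintro _ ⟨c, hc, x, -, d, hd, rfl⟩
  rw [star_mul, star_mul, ← mul_assoc]
  exact mul_mul_mem_linkingAlgebra (star_mem_diagonalAlgebra hd) _ (star_mem_diagonalAlgebra hc)

lemma mem_linkingAlgebra (hV : IsCorner V) (h : star x * x ∈ diagonalAlgebra V)
    (h' : x * star x ∈ diagonalAlgebra V) : x ∈ linkingAlgebra V := by
  have hcl := isClosed_closedSpanSubmodule (MulSet3 (diagonalAlgebra V) univ (diagonalAlgebra V))
  refine mem_of_mul_star_mul_mem hcl ?_ fun n hn => hV.linkingAlgebra_mul_mem hn h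
  set y := x * (star x * x) with hy
  have hyy : star y * y = star x * x * (star x * x) * (star x * x) := by
    simp only [hy, star_mul, star_star, mul_assoc]
  have hyy' : star y * y ∈ diagonalAlgebra V :=
    hyy ▸ hV.mul_mem_diagonalAlgebra (hV.mul_mem_diagonalAlgebra h h) h
  refine mem_of_mul_star_mul_mem hcl ?_ fun n hn => hV.linkingAlgebra_mul_mem hn hyy'
  have := mul_mul_mem_linkingAlgebra h' x
    (hV.mul_mem_diagonalAlgebra (hV.mul_mem_diagonalAlgebra h h) h)
  rw [hyy, mem_closedSpanSubmodule]
  simpa only [hy, mul_assoc] using this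

lemma mem_linkingAlgebra_of_mem (hV : IsCorner V) (hx : x ∈ V) : x ∈ linkingAlgebra V :=
  hV.mem_linkingAlgebra (source_subset_diagonal (star_mul_mem_sourceAlgebra hx hx))
    (range_subset_diagonal (mul_star_mem_rangeAlgebra hx hx))

lemma diagonal_subset_linking (hV : IsCorner V) : diagonalAlgebra V ⊆ linkingAlgebra V :=
  fun _ ha => hV.mem_linkingAlgebra (hV.mul_mem_diagonalAlgebra (star_mem_diagonalAlgebra ha) ha)
    (hV.mul_mem_diagonalAlgebra ha (star_mem_diagonalAlgebra ha))

variable {K : Set A}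

/-- An ideal of the linking algebra which contains the closed span of `V V*` is everything. -/
lemma linkingAlgebra_subset (hV : IsCorner V) (hK : IsClosedTwoSidedIdealIn (linkingAlgebra V) K)
    (hJ : rangeAlgebra V ⊆ K) : linkingAlgebra V ⊆ K := by
  obtain ⟨-, hKc, -, -, -, hKmul⟩ := id hK
  have hI : sourceAlgebra V ⊆ K := by
    refine hV.sourceAlgebra_subset (N := hK.toSubmodule) hKc (fun x hx j hj y hy => ?_)
      fun n hn i hi => (hKmul i (hV.diagonal_subset_linking (source_subset_diagonal hi)) n hn).2
    exact (hKmul y (hV.mem_linkingAlgebra_of_mem hy) _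
      (hKmul _ (star_mem_linkingAlgebra (hV.mem_linkingAlgebra_of_mem hx)) j (hJ hj)).1).2
  have hD : diagonalAlgebra V ⊆ K := by
    rintro _ ⟨i, hi, j, hj, rfl⟩
    exact hK.toSubmodule.add_mem (hI hi) (hJ hj)
  intro z hz
  refine mem_of_mem_closedSpan (N := hK.toSubmodule) hKc ?_ hz
  rintro _ ⟨a, ha, x, -, b, hb, rfl⟩
  have : a * (x * b) ∈ K := by
    refine map_mem_of_mem_closedSpan (N := hK.toSubmodule) hKc
      ((ContinuousLinearMap.mul ℂ A).flip (x * b)) ?_ (hV.diagonal_subset_closedSpan_mul ha)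
    rintro _ ⟨c, hc, d, hd, rfl⟩
    have := (hKmul _ (mul_mul_mem_linkingAlgebra hd x hb) c (hD hc)).2
    change c * d * (x * b) ∈ K
    simpa only [mul_assoc] using this
  rwa [← mul_assoc] at this

/-- An ideal of the linking algebra which meets the closed span of `V V*` trivially is trivial. -/
lemma eq_singleton_zero (hV : IsCorner V) (hK : IsClosedTwoSidedIdealIn (linkingAlgebra V) K)
    (hJ : K ∩ rangeAlgebra V = {0}) : K = {0} := by
  obtain ⟨hKZ, -, hK0, -, -, hKmul⟩ := id hK
  refine subset_antisymm (fun k hk => ?_) (by simpa using hK0)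
  have hmul : ∀ g ∈ linkingAlgebra V, ∀ h ∈ linkingAlgebra V, g * k * h ∈ rangeAlgebra V →
      g * k * h = 0 := fun g hg h hh hR => by
    have : g * k * h ∈ K ∩ rangeAlgebra V := ⟨(hKmul h hh _ (hKmul g hg k hk).1).2, hR⟩
    rwa [hJ] at this
  have hVZ : ∀ x ∈ V, x ∈ linkingAlgebra V := fun x hx => hV.mem_linkingAlgebra_of_mem hx
  have hRZ : ∀ x ∈ V, ∀ y ∈ V, x * star y ∈ linkingAlgebra V := fun x hx y hy =>
    hV.diagonal_subset_linking (range_subset_diagonal (mul_star_mem_rangeAlgebra hx hy))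
  have h11 : ∀ x ∈ V, ∀ y ∈ V, x * k * star y = 0 := fun x hx y hy => by
    refine hmul x (hVZ x hx) _ (star_mem_linkingAlgebra (hVZ y hy)) ?_
    obtain ⟨x', hx', h⟩ := hV.exists_mul_star x hx k y hy
    exact h ▸ mul_star_mem_rangeAlgebra hx' hy
  have h12 : ∀ x ∈ V, ∀ y ∈ V, ∀ z ∈ V, x * k * (y * star z) = 0 := fun x hx y hy z hz => by
    refine hmul x (hVZ x hx) _ (hRZ y hy z hz) ?_
    rw [← mul_assoc]
    exact mul_star_mem_rangeAlgebra (hV.mul_mul_mem x hx k y hy) hz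
  have h21 : ∀ x ∈ V, ∀ y ∈ V, ∀ z ∈ V, x * star y * k * star z = 0 := fun x hx y hy z hz => by
    refine hmul _ (hRZ x hx y hy) _ (star_mem_linkingAlgebra (hVZ z hz)) ?_
    have := mul_star_mem_rangeAlgebra hx (hV.mul_mul_mem z hz (star k) y hy)
    simpa only [star_mul, star_star, mul_assoc] using this
  have h22 : ∀ x ∈ V, ∀ y ∈ V, ∀ z ∈ V, ∀ w ∈ V, x * star y * k * (z * star w) = 0 :=
    fun x hx y hy z hz w hw => by
    refine hmul _ (hRZ x hx y hy) _ (hRZ z hz w hw) ?_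
    have := mul_star_mem_rangeAlgebra (hV.mul_mul_mem x hx (star y * k) z hz) hw
    simpa only [mul_assoc] using this
  have hD : ∀ a ∈ diagonalAlgebra V, ∀ b ∈ diagonalAlgebra V, a * k * b = 0 := by
    rintro _ ⟨i, hi, j, hj, rfl⟩ _ ⟨i', hi', j', hj', rfl⟩
    have hbot : IsClosed ((⊥ : Submodule ℂ A) : Set A) := isClosed_singleton
    have e1 : i * k * i' ∈ (⊥ : Submodule ℂ A) := by
      refine mul_mul_mem_of_mem_closedSpan hbot k ?_ hi hi'
      rintro _ ⟨x, hx, y, hy, rfl⟩ _ ⟨z, hz, w, hw, rfl⟩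
      rw [show star x * y * k * (star z * w) = star x * (y * k * star z) * w by
        simp only [mul_assoc], h11 y hy z hz]
      simp
    have e2 : i * k * j' ∈ (⊥ : Submodule ℂ A) := by
      refine mul_mul_mem_of_mem_closedSpan hbot k ?_ hi hj'
      rintro _ ⟨x, hx, y, hy, rfl⟩ _ ⟨z, hz, w, hw, rfl⟩
      rw [mul_assoc (star x), mul_assoc (star x), h12 y hy z hz w hw]
      simp
    have e3 : j * k * i' ∈ (⊥ : Submodule ℂ A) := by
      refine mul_mul_mem_of_mem_closedSpan hbot k ?_ hj hi'
      rintro _ ⟨x, hx, y, hy, rfl⟩ _ ⟨z, hz, w, hw, rfl⟩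
      rw [← mul_assoc _ (star z), h21 x hx y hy z hz]
      simp
    have e4 : j * k * j' ∈ (⊥ : Submodule ℂ A) := by
      refine mul_mul_mem_of_mem_closedSpan hbot k ?_ hj hj'
      rintro _ ⟨x, hx, y, hy, rfl⟩ _ ⟨z, hz, w, hw, rfl⟩
      exact (Submodule.mem_bot ℂ).2 (h22 x hx y hy z hz w hw)
    rw [Submodule.mem_bot] at e1 e2 e3 e4
    simp only [add_mul, mul_add, e1, e2, e3, e4, add_zero]
  have hs := star_mem_linkingAlgebra (hKZ hk)
  refine eq_zero_of_mul_mul_eq_zero ((Submodule.mem_bot ℂ).1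
    (mul_mul_mem_of_mem_closedSpan isClosed_singleton k ?_ hs hs))
  rintro _ ⟨a, -, x, -, b, hb, rfl⟩ _ ⟨c, hc, y, -, d, -, rfl⟩
  rw [show a * x * b * k * (c * y * d) = a * x * (b * k * c) * (y * d) by
    simp only [mul_assoc], hD b hb c hc]
  simp

/-- If the closed span of `V V*` is simple, then so is the linking algebra. -/
theorem linkingAlgebra_simple (hV : IsCorner V)
    (hsimple : ∀ K, IsClosedTwoSidedIdealIn (rangeAlgebra V) K → K = {0} ∨ K = rangeAlgebra V)
    (K : Set A) (hK : IsClosedTwoSidedIdealIn (linkingAlgebra V) K) :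
    K = {0} ∨ K = linkingAlgebra V := by
  have hJZ : rangeAlgebra V ⊆ linkingAlgebra V :=
    range_subset_diagonal.trans hV.diagonal_subset_linking
  have hKJ : IsClosedTwoSidedIdealIn (rangeAlgebra V) (K ∩ rangeAlgebra V) :=
    ⟨inter_subset_right, hK.2.1.inter (isClosed_closedSpan _),
      (hK.toSubmodule ⊓ closedSpanSubmodule _).zero_mem,
      fun _ ha _ hb => (hK.toSubmodule ⊓ closedSpanSubmodule _).add_mem ha hb,
      fun c _ ha => (hK.toSubmodule ⊓ closedSpanSubmodule _).smul_mem c ha,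
      fun s hs k hk => ⟨⟨(hK.2.2.2.2.2 s (hJZ hs) k hk.1).1, hV.mul_mem_rangeAlgebra hs hk.2⟩,
        ⟨(hK.2.2.2.2.2 s (hJZ hs) k hk.1).2, hV.mul_mem_rangeAlgebra hk.2 hs⟩⟩⟩
  rcases hsimple _ hKJ with h | h
  · exact .inl (hV.eq_singleton_zero hK h)
  · exact .inr (subset_antisymm hK.1
      (hV.linkingAlgebra_subset hK (h ▸ inter_subset_left)))

end IsCorner

end Corner

section Dynamics

variable {A : Type*} [NonUnitalCStarAlgebra A] {α : ℝ → A → A} {γ : ℝ} {m n : ℤ} {x y : A}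

/-- The *-endomorphism `α t` of a C*-dynamical system. -/
def IsCStarDynSys.toHom (hα : IsCStarDynSys α) (t : ℝ) : A →⋆ₙₐ[ℂ] A where
  toFun := α t
  map_smul' := hα.map_smulc t
  map_zero' := by simpa using hα.map_smulc t 0 0
  map_add' := hα.map_add t
  map_mul' := hα.map_mul t
  map_star' := hα.map_star t

open scoped CStarAlgebra in
/-- The automorphism `α t` as a continuous linear map. -/
def IsCStarDynSys.toCLM (hα : IsCStarDynSys α) (t : ℝ) : A →L[ℂ] A where
  toFun := α t
  map_smul' := hα.map_smulc t
  map_add' := hα.map_add t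
  cont := map_continuous (hα.toHom t)

/-- The spectral subspace `specZ α γ n` as a subspace. -/
def specZSubmodule (hα : IsCStarDynSys α) (γ : ℝ) (n : ℤ) : Submodule ℂ A where
  carrier := specZ α γ n
  zero_mem' := fun t => by rw [smul_zero]; exact (hα.toCLM t).map_zero
  add_mem' := fun ha hb t => by rw [hα.map_add, ha t, hb t, smul_add]
  smul_mem' := fun c a ha t => by rw [hα.map_smulc, ha t, smul_comm]

lemma isClosed_specZ (hα : IsCStarDynSys α) (γ : ℝ) (n : ℤ) : IsClosed (specZ α γ n) := by
  have : specZ α γ n =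
      ⋂ t, {x | α t x = Complex.exp (Complex.I * (((n : ℝ) * γ * t : ℝ) : ℂ)) • x} := by
    ext x
    simp [specZ]
  rw [this]
  exact isClosed_iInter fun t =>
    isClosed_eq (hα.toCLM t).continuous (continuous_const_smul _)

lemma mul_mem_specZ (hα : IsCStarDynSys α) (hx : x ∈ specZ α γ m) (hy : y ∈ specZ α γ n) :
    x * y ∈ specZ α γ (m + n) := fun t => by
  rw [hα.map_mul, hx t, hy t, smul_mul_smul_comm, ← Complex.exp_add]
  congr 2
  push_cast
  ring

lemma star_mem_specZ (hα : IsCStarDynSys α) (hx : x ∈ specZ α γ n) :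
    star x ∈ specZ α γ (-n) := fun t => by
  rw [hα.map_star, hx t, star_smul]
  congr 1
  rw [Complex.star_def, ← Complex.exp_conj]
  congr 1
  simp

/-- The orbit of `x` as a continuous function on the circle. -/
def orbitMap (hα : IsCStarDynSys α) {T : ℝ} (hper : ∀ x, α T x = x) (x : A) :
    C(AddCircle T, A) where
  toFun := Function.Periodic.lift (f := fun t => α t x) (c := T)
    fun t => (hα.map_add_time t T x).trans (congrArg (α t) (hper x))
  continuous_toFun :=
    (QuotientAddGroup.isQuotientMap_mk _).continuous_iff.2 (hα.continuous_orbit x)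

lemma orbitMap_coe (hα : IsCStarDynSys α) {T : ℝ} (hper : ∀ x, α T x = x) (x : A) (t : ℝ) :
    orbitMap hα hper x (t : AddCircle T) = α t x := rfl

lemma fourier_two_pi_div (hγ : 0 < γ) (n : ℤ) (t : ℝ) :
    fourier n (t : AddCircle (2 * Real.pi / γ)) =
      Complex.exp (Complex.I * (((n : ℝ) * γ * t : ℝ) : ℂ)) := by
  rw [fourier_coe_apply]
  congr 1
  have : (γ : ℂ) ≠ 0 := by exact_mod_cast hγ.ne'
  have hpi : (Real.pi : ℂ) ≠ 0 := by exact_mod_cast Real.pi_ne_zero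
  push_cast
  field_simp

lemma fourierCoeff_orbitMap_mem (hα : IsCStarDynSys α) (hγ : 0 < γ)
    [Fact (0 < 2 * Real.pi / γ)] (hper : ∀ x, α (2 * Real.pi / γ) x = x) (x : A) (n : ℤ) :
    fourierCoeff (orbitMap hα hper x) n ∈ specZ α γ n := by
  intro s
  set T := 2 * Real.pi / γ with hT
  let g : ℝ → A := fun t => fourier (-n) (t : AddCircle T) • orbitMap hα hper x (t : AddCircle T)
  have hg : Continuous g := by fun_prop
  have hgper : Function.Periodic g T := fun t => by
    simp only [g, AddCircle.coe_add_period]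
  have hshift (t : ℝ) : α s (g t) =
      Complex.exp (Complex.I * (((n : ℝ) * γ * s : ℝ) : ℂ)) • g (t + s) := by
    simp only [g, orbitMap_coe, hα.map_smulc, ← hα.map_add_time, smul_smul]
    rw [fourier_two_pi_div hγ, fourier_two_pi_div hγ, ← Complex.exp_add, add_comm s t]
    congr 2
    push_cast
    ring
  have key : α s (∫ t in (0 : ℝ)..0 + T, g t) =
      Complex.exp (Complex.I * (((n : ℝ) * γ * s : ℝ) : ℂ)) • ∫ t in (0 : ℝ)..0 + T, g t := by
    calc α s (∫ t in (0 : ℝ)..0 + T, g t) = ∫ t in (0 : ℝ)..0 + T, α s (g t) :=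
          ((hα.toCLM s).intervalIntegral_comp_comm (hg.intervalIntegrable _ _)).symm
      _ = _ := by
          simp only [hshift]
          rw [intervalIntegral.integral_smul, intervalIntegral.integral_comp_add_right,
            add_right_comm, hgper.intervalIntegral_add_eq (0 + s) 0]
  rw [fourierCoeff_eq_intervalIntegral _ _ 0]
  change α s ((1 / T) • ∫ t in (0 : ℝ)..0 + T, g t) = _ • ((1 / T) • ∫ t in (0 : ℝ)..0 + T, g t)
  rw [← Complex.coe_smul, hα.map_smulc, key, smul_comm]

/-- For an action with spectrum in `{-γ, 0, γ}` the spectral subspaces span the algebra. -/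
theorem exists_eq_add_add (hα : IsCStarDynSys α) (hγ : 0 < γ)
    (hper : ∀ x, α (2 * Real.pi / γ) x = x) (h2 : ∀ n : ℤ, 2 ≤ |n| → specZ α γ n = {0}) (x : A) :
    ∃ u ∈ specZ α γ (-1), ∃ v ∈ specZ α γ 0, ∃ w ∈ specZ α γ 1, x = u + v + w := by
  have : Fact (0 < 2 * Real.pi / γ) := ⟨by positivity⟩
  set f := orbitMap hα hper x
  have hmem := fourierCoeff_orbitMap_mem hα hγ hper x
  refine ⟨_, hmem (-1), _, hmem 0, _, hmem 1, ?_⟩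
  rw [SeparatingDual.eq_iff_forall_dual_eq (R := ℂ)]
  intro φ
  let F : C(AddCircle (2 * Real.pi / γ), ℂ) := ⟨fun t => φ (f t), by fun_prop⟩
  have hF (n : ℤ) : fourierCoeff F n = φ (fourierCoeff f n) := by
    have hint : Integrable (fun t => fourier (-n) t • f t)
        (AddCircle.haarAddCircle (T := 2 * Real.pi / γ)) :=
      (by fun_prop : Continuous fun t => fourier (-n) t • f t).integrable_of_hasCompactSupport
        (HasCompactSupport.of_compactSpace _)
    rw [fourierCoeff, fourierCoeff, ← φ.integral_comp_comm hint]
    simp [F]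
  have hzero : ∀ n ∉ ({-1, 0, 1} : Finset ℤ), fourierCoeff F n = 0 := fun n hn => by
    have hn2 : 2 ≤ |n| := by
      simp only [Finset.mem_insert, Finset.mem_singleton] at hn
      grind
    have := hmem n
    rw [h2 n hn2] at this
    rw [hF, this, map_zero]
  have hsum := has_pointwise_sum_fourier_series_of_summable
    (summable_of_ne_finset_zero (s := {-1, 0, 1}) hzero) 0
  have hsum' := hasSum_sum_of_ne_finset_zero
    (f := fun i => fourierCoeff F i • fourier i (0 : AddCircle (2 * Real.pi / γ)))
    (s := {-1, 0, 1}) (L := SummationFilter.unconditional ℤ) fun n hn => by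
      rw [hzero n hn, zero_smul]
  have hF0 : F 0 = φ x := congrArg φ (hα.map_zero_time x)
  rw [← hF0, hsum.unique hsum']
  simp [hF, f, add_assoc]

/-- For an action with spectrum in `{-γ, 0, γ}` the spectral subspace of `γ` is a corner. -/
theorem isCorner_specZ (hα : IsCStarDynSys α) (hγ : 0 < γ)
    (hper : ∀ x, α (2 * Real.pi / γ) x = x) (h2 : ∀ n : ℤ, 2 ≤ |n| → specZ α γ n = {0}) :
    IsCorner (specZ α γ 1) := by
  have hz : ∀ x ∈ specZ α γ 1, ∀ y ∈ specZ α γ 1, x * y = 0 := fun x hx y hy => by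
    have := mul_mem_specZ hα hx hy
    rwa [h2 (1 + 1) (by norm_num)] at this
  refine ⟨hz, fun x hx k y hy => ?_, fun x hx k y hy => ?_⟩ <;>
    obtain ⟨u, hu, v, hv, w, hw, rfl⟩ := exists_eq_add_add hα hγ hper h2 k
  · have hvy : v * y ∈ specZ α γ 1 := by simpa using mul_mem_specZ hα hv hy
    have hxu : x * u ∈ specZ α γ 0 := by simpa using mul_mem_specZ hα hx hu
    rw [mul_add, mul_add, hz x hx w hw, add_zero, add_mul, mul_assoc x v, hz x hx _ hvy, add_zero]
    simpa using mul_mem_specZ hα hxu hy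
  · have hyu : y * star u = 0 := hz y hy _ (by simpa using star_mem_specZ hα hu)
    have huy : u * star y = 0 := by rw [← star_eq_zero, star_mul, star_star, hyu]
    refine ⟨x * v, by simpa using mul_mem_specZ hα hx hv, ?_⟩
    rw [mul_add, mul_add, hz x hx w hw, add_zero, add_mul, mul_assoc x u, huy, mul_zero, zero_add]

lemma sourceAlgebra_isClosedTwoSidedIdealIn (hα : IsCStarDynSys α) :
    IsClosedTwoSidedIdealIn (specZ α γ 0) (sourceAlgebra (specZ α γ 1)) := by
  refine isClosedTwoSidedIdealIn_closedSpan (fun a ha => ?_) ?_ ?_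
  · refine mem_of_mem_closedSpan (N := specZSubmodule hα γ 0) (isClosed_specZ hα γ 0) ?_ ha
    rintro _ ⟨x, hx, y, hy, rfl⟩
    have : star x * y ∈ specZ α γ (-1 + 1) := mul_mem_specZ hα (star_mem_specZ hα hx) hy
    exact this
  · rintro s hs _ ⟨x, hx, y, hy, rfl⟩
    have hxs : x * star s ∈ specZ α γ 1 := by
      simpa using mul_mem_specZ hα hx (star_mem_specZ hα hs)
    have := star_mul_mem_sourceAlgebra hxs hy
    rwa [star_mul, star_star, mul_assoc] at this
  · rintro s hs _ ⟨x, hx, y, hy, rfl⟩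
    rw [mul_assoc]
    exact star_mul_mem_sourceAlgebra hx (by simpa using mul_mem_specZ hα hy hs)

end Dynamics

/-- **Proposition 4.6 i), ii).** For a periodic system with `sp(α) = {−γ₁, 0, γ₁}` in which
`J`, the closed span of `X_1 X_1*`, is a simple ideal of `X_0`: (i) `I`, the closed span of
`X_1* X_1`, is a simple ideal of `X_0` and `I J = {0}`; (ii) `Z`, the closed span of
`(I+J) X (I+J)`, is a simple C*-algebra. -/
theorem condition43a_structure (α : ℝ → X → X) (hα : IsCStarDynSys α)
    (γ₁ : ℝ) (hγ₁ : 0 < γ₁) (hper : ∀ x : X, α (2 * Real.pi / γ₁) x = x)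
    (h1 : specZ α γ₁ 1 ≠ ({0} : Set X))
    (h2 : ∀ n : ℤ, 2 ≤ |n| → specZ α γ₁ n = ({0} : Set X))
    (hJideal : IsClosedTwoSidedIdealIn (specZ α γ₁ 0)
      (ClosedSpan {z : X | ∃ x ∈ specZ α γ₁ 1, ∃ y ∈ specZ α γ₁ 1, z = x * star y}))
    (hJsimple : ∀ K : Set X,
      IsClosedTwoSidedIdealIn
        (ClosedSpan {z : X | ∃ x ∈ specZ α γ₁ 1, ∃ y ∈ specZ α γ₁ 1, z = x * star y}) K →
      K = ({0} : Set X) ∨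
        K = ClosedSpan {z : X | ∃ x ∈ specZ α γ₁ 1, ∃ y ∈ specZ α γ₁ 1, z = x * star y}) :
    (IsClosedTwoSidedIdealIn (specZ α γ₁ 0)
        (ClosedSpan {z : X | ∃ x ∈ specZ α γ₁ 1, ∃ y ∈ specZ α γ₁ 1, z = star x * y}) ∧
      (∀ K : Set X,
        IsClosedTwoSidedIdealIn
          (ClosedSpan {z : X | ∃ x ∈ specZ α γ₁ 1, ∃ y ∈ specZ α γ₁ 1, z = star x * y}) K →
        K = ({0} : Set X) ∨
          K = ClosedSpan {z : X | ∃ x ∈ specZ α γ₁ 1, ∃ y ∈ specZ α γ₁ 1, z = star x * y}) ∧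
      ∀ i ∈ ClosedSpan {z : X | ∃ x ∈ specZ α γ₁ 1, ∃ y ∈ specZ α γ₁ 1, z = star x * y},
        ∀ j ∈ ClosedSpan {z : X | ∃ x ∈ specZ α γ₁ 1, ∃ y ∈ specZ α γ₁ 1, z = x * star y},
          i * j = 0) ∧
    (∀ K : Set X,
      IsClosedTwoSidedIdealIn
        (ClosedSpan (MulSet3
          ((ClosedSpan {z : X | ∃ x ∈ specZ α γ₁ 1, ∃ y ∈ specZ α γ₁ 1, z = star x * y}) +
           (ClosedSpan {z : X | ∃ x ∈ specZ α γ₁ 1, ∃ y ∈ specZ α γ₁ 1, z = x * star y}))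
          (univ : Set X)
          ((ClosedSpan {z : X | ∃ x ∈ specZ α γ₁ 1, ∃ y ∈ specZ α γ₁ 1, z = star x * y}) +
           (ClosedSpan {z : X | ∃ x ∈ specZ α γ₁ 1, ∃ y ∈ specZ α γ₁ 1, z = x * star y}))))
        K →
      K = ({0} : Set X) ∨
        K = ClosedSpan (MulSet3
          ((ClosedSpan {z : X | ∃ x ∈ specZ α γ₁ 1, ∃ y ∈ specZ α γ₁ 1, z = star x * y}) +
           (ClosedSpan {z : X | ∃ x ∈ specZ α γ₁ 1, ∃ y ∈ specZ α γ₁ 1, z = x * star y}))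
          (univ : Set X)
          ((ClosedSpan {z : X | ∃ x ∈ specZ α γ₁ 1, ∃ y ∈ specZ α γ₁ 1, z = star x * y}) +
           (ClosedSpan {z : X | ∃ x ∈ specZ α γ₁ 1, ∃ y ∈ specZ α γ₁ 1, z = x * star y})))) := by
  let _ : NonUnitalCStarAlgebra X := {}
  have hV : IsCorner (specZ α γ₁ 1) := isCorner_specZ hα hγ₁ hper h2
  exact ⟨⟨sourceAlgebra_isClosedTwoSidedIdealIn hα, hV.sourceAlgebra_simple hJsimple,
    fun _ hi _ hj => hV.source_mul_range hi hj⟩, hV.linkingAlgebra_simple hJsimple⟩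

end PeligradMax
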